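/- (Correctness of ID/IDS learning.) Let A be a DFA, P ⊆ Σ* a live complete set for A with λ ∈ P, and V ⊆ Σ* with λ ∈ V such that V is closed for P, and let rep be any representative function for (V, P). Then the hypothesis DFA M = M(A, V, P, rep) accepts exactly the language of A: L(M) = L(A). (In particular, if S = s_1, …, s_l is any sequence of strings such that {λ, s_1, …, s_l} is live complete for A, then the automaton output by the prefix free IDS algorithm after processing S — and likewise by prefix closed IDS, and by ID on input set {λ, s_1, …, s_l} — accepts L(A).) -/

import Mathlib

/-- The row of a string `x` with respect to a set `V` of distinguishing strings:
`E_V(x) = {v ∈ V : x ++ v ∈ L(A)}`. -/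
def row {α σ : Type*} (A : DFA α σ) (V : Set (List α)) (x : List α) : Set (List α) :=
  {v ∈ V | x ++ v ∈ A.accepts}

/-- A state is live if some string leads from it to an accepting state. -/
def Live {α σ : Type*} (A : DFA α σ) (q : σ) : Prop :=
  ∃ w : List α, A.evalFrom q w ∈ A.accept

/-- A finite set `P` of strings is live complete for `A` if every live state is reached
from the initial state by some string of `P`. -/
def LiveComplete {α σ : Type*} (A : DFA α σ) (P : Set (List α)) : Prop :=
  P.Finite ∧ ∀ q : σ, Live A q → ∃ a ∈ P, A.eval a = q

/-- `V` is closed for `P`: (a) equal rows of members of `P` remain equal after any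
one-symbol extension, and (b) empty rows of members of `P` remain empty after any
one-symbol extension. -/
def ClosedFor {α σ : Type*} (A : DFA α σ) (V P : Set (List α)) : Prop :=
  (∀ a ∈ P, ∀ c ∈ P, ∀ b : α,
      row A V a = row A V c → row A V (a ++ [b]) = row A V (c ++ [b])) ∧
  (∀ a ∈ P, ∀ b : α, row A V a = ∅ → row A V (a ++ [b]) = ∅)

/-- `rep` is a representative function for `(V, P)`: it assigns to each nonempty row of a
string of `P` a string of `P` having that row. -/
def IsRepFun {α σ : Type*} (A : DFA α σ) (V P : Set (List α))
    (rep : Set (List α) → List α) : Prop :=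
  ∀ r : Set (List α), (∃ a ∈ P, row A V a = r) → r ≠ ∅ →
    rep r ∈ P ∧ row A V (rep r) = r

open Classical in
/-- The transition function of the hypothesis DFA: on a nonempty row of a string of `P`,
step via a representative; on all other state names, go to the empty (dead) state. -/
noncomputable def hypStep {α σ : Type*} (A : DFA α σ) (V P : Set (List α))
    (rep : Set (List α) → List α) (r : Set (List α)) (b : α) : Set (List α) :=
  if (∃ a ∈ P, row A V a = r) ∧ r ≠ ∅ then row A V (rep r ++ [b]) else ∅

/-- The hypothesis DFA `M(A, V, P, rep)`: states are subsets of `Σ*`, the start state is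
`E_V(λ)`, accepting states are the rows containing `λ`, and transitions are `hypStep`. -/
noncomputable def hypDFA {α σ : Type*} (A : DFA α σ) (V P : Set (List α))
    (rep : Set (List α) → List α) : DFA α (Set (List α)) where
  step := hypStep A V P rep
  start := row A V []
  accept := {r : Set (List α) | [] ∈ r}

theorem row_congr {α σ : Type*} {A : DFA α σ} (V : Set (List α)) {x y : List α}
    (h : A.eval x = A.eval y) : row A V x = row A V y := by
  have h' : A.evalFrom A.start x = A.evalFrom A.start y := h
  ext v
  simp only [row, Set.mem_ofPred_eq, DFA.mem_accepts, DFA.eval, DFA.evalFrom_of_append, h']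

theorem row_eq_empty_of_not_live {α σ : Type*} {A : DFA α σ} (V : Set (List α)) {x : List α}
    (h : ¬ Live A (A.eval x)) : row A V x = ∅ := by
  refine Set.eq_empty_of_forall_notMem fun v hv => h ⟨v, ?_⟩
  have hacc := hv.2
  rwa [DFA.mem_accepts, DFA.eval, DFA.evalFrom_of_append] at hacc

theorem Live.of_step {α σ : Type*} {A : DFA α σ} {q : σ} {b : α} (h : Live A (A.step q b)) :
    Live A q := by
  obtain ⟨w, hw⟩ := h
  exact ⟨b :: w, by simpa using hw⟩

theorem hypStep_row {α σ : Type*} {A : DFA α σ} {V P : Set (List α)} (hP : LiveComplete A P)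
    (hcl : ClosedFor A V P) {rep : Set (List α) → List α} (hrep : IsRepFun A V P rep)
    (w : List α) (b : α) : hypStep A V P rep (row A V w) b = row A V (w ++ [b]) := by
  unfold hypStep
  by_cases hlive : Live A (A.eval w)
  · obtain ⟨a, ha, haw⟩ := hP.2 _ hlive
    have hrow : row A V a = row A V w := row_congr V haw
    have hrow' : row A V (a ++ [b]) = row A V (w ++ [b]) :=
      row_congr V (by rw [DFA.eval_append_singleton, DFA.eval_append_singleton, haw])
    split_ifs with h
    · obtain ⟨hmem, heq⟩ := hrep _ h.1 h.2
      rw [← hrow']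
      exact hcl.1 _ hmem a ha b (heq.trans hrow.symm)
    · have hempty : row A V w = ∅ := by
        by_contra hne
        exact h ⟨⟨a, ha, hrow⟩, hne⟩
      rw [← hrow', hcl.2 a ha b (hrow.trans hempty)]
  · rw [if_neg fun h => h.2 (row_eq_empty_of_not_live V hlive), row_eq_empty_of_not_live V]
    rw [DFA.eval_append_singleton]
    exact fun h => hlive h.of_step

theorem hypDFA_eval {α σ : Type*} {A : DFA α σ} {V P : Set (List α)} (hP : LiveComplete A P)
    (hcl : ClosedFor A V P) {rep : Set (List α) → List α} (hrep : IsRepFun A V P rep)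
    (w : List α) : (hypDFA A V P rep).eval w = row A V w := by
  induction w using List.reverseRecOn with
  | nil => rfl
  | append_singleton w b ih =>
    rw [DFA.eval_append_singleton, ih]
    exact hypStep_row hP hcl hrep w b

/-- Correctness of ID/IDS learning: the hypothesis DFA constructed from a live complete
set `P` and a set `V` closed for `P` accepts exactly the language of the target DFA. -/
theorem hypDFA_accepts_eq {α σ : Type*} [Fintype α] [Fintype σ]
    (A : DFA α σ) (V P : Set (List α)) (hP : LiveComplete A P)
    (hnilP : ([] : List α) ∈ P) (hnilV : ([] : List α) ∈ V) (hcl : ClosedFor A V P)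
    (rep : Set (List α) → List α) (hrep : IsRepFun A V P rep) :
    (hypDFA A V P rep).accepts = A.accepts := by
  ext w
  have hmem : w ∈ (hypDFA A V P rep).accepts ↔ [] ∈ row A V w := by
    rw [DFA.mem_accepts, hypDFA_eval hP hcl hrep]
    rfl
  rw [hmem]
  simp [row, hnilV]
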